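/- arXiv:2010.05068 — 2 statements merged into one kernel-verified Lean document; each statement's English description precedes it below -/
import Mathlib

section
/- (Integral 1 of the main Theorem, Euclidean case.) Let n ≥ 1 and V : ℝⁿ → ℝ smooth. Suppose: C_{ab}(q) is a smooth symmetric field with ∂_{(c}C_{ab)} = 0 (a Killing tensor); L_a(q) is a smooth vector field such that L_{(a,b)} := (∂_a L_b + ∂_b L_a)/2 is also a Killing tensor, i.e. ∂_{(c}L_{(a,b))} = 0; the compatibility condition ∂_a(L_b ∂_b V) = −2 L_{(a,b)} ∂_b V holds; and G : ℝⁿ → ℝ is a smooth function with ∂_a G = 2 C_{ab} ∂_b V − L_a. Then I₁ = −(t²/2) L_{(a,b)} q̇^a q̇^b + C_{ab} q̇^a q̇^b + t L_a q̇^a + (t²/2) L_a ∂_a V + G(q) is constant along every C² solution of q̈^a = −∂V/∂q^a. -/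
open Real Set
open scoped ContDiff

/-- Partial derivative of a scalar field on `ℝⁿ` with respect to the `a`-th coordinate. -/
noncomputable def pd {n : ℕ} (f : (Fin n → ℝ) → ℝ) (q : Fin n → ℝ) (a : Fin n) : ℝ :=
  fderiv ℝ f q (Pi.single a 1)

/-- The symmetrized derivative `L_{(a,b)} = (∂_a L_b + ∂_b L_a)/2` of a vector field on `ℝⁿ`. -/
noncomputable def symD {n : ℕ} (L : (Fin n → ℝ) → Fin n → ℝ) (q : Fin n → ℝ) (a b : Fin n) : ℝ :=
  (pd (fun q => L q b) q a + pd (fun q => L q a) q b) / 2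

/-- Partial derivatives of smooth functions are smooth. -/
theorem contDiff_pd {n : ℕ} {f : (Fin n → ℝ) → ℝ} (hf : ContDiff ℝ ∞ f) (a : Fin n) :
    ContDiff ℝ ∞ (fun x => pd f x a) :=
  (hf.fderiv_right (m := ∞) (by norm_cast)).clm_apply contDiff_const

/-- The symmetrized derivative of a smooth vector field is smooth. -/
theorem contDiff_symD {n : ℕ} {L : (Fin n → ℝ) → Fin n → ℝ}
    (hL : ∀ a, ContDiff ℝ ∞ (fun x => L x a)) (a b : Fin n) :
    ContDiff ℝ ∞ (fun x => symD L x a b) :=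
  ((contDiff_pd (hL b) a).add (contDiff_pd (hL a) b)).div_const 2

theorem symD_comm {n : ℕ} (L : (Fin n → ℝ) → Fin n → ℝ) (x : Fin n → ℝ) (a b : Fin n) :
    symD L x a b = symD L x b a := by
  unfold symD
  rw [add_comm]

/-- The quadratic form of `∂_a L_b` only sees its symmetric part. -/
theorem sum_pd_mul_mul_eq_sum_symD {n : ℕ} (L : (Fin n → ℝ) → Fin n → ℝ) (x v : Fin n → ℝ) :
    ∑ a, (∑ c, pd (fun y => L y a) x c * v c) * v a = ∑ a, ∑ b, symD L x a b * v a * v b := by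
  have h : ∑ a, ∑ b, pd (fun y => L y b) x a * v a * v b
      = ∑ a, ∑ b, pd (fun y => L y a) x b * v a * v b := by
    rw [Finset.sum_comm]
    exact Finset.sum_congr rfl fun a _ => Finset.sum_congr rfl fun b _ => by ring
  have h' : ∑ a, ∑ b, symD L x a b * v a * v b
      = (∑ a, ∑ b, pd (fun y => L y b) x a * v a * v b
        + ∑ a, ∑ b, pd (fun y => L y a) x b * v a * v b) / 2 := by
    simp only [← Finset.sum_add_distrib, Finset.sum_div]
    exact Finset.sum_congr rfl fun a _ => Finset.sum_congr rfl fun b _ => by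
      unfold symD
      ring
  rw [h', h, add_self_div_two]
  simp only [Finset.sum_mul]
  exact Finset.sum_congr rfl fun a _ => Finset.sum_congr rfl fun b _ => by ring

/-- The cubic form of an array with vanishing cyclic sums vanishes. -/
theorem sum_cubic_eq_zero_of_cyclic {n : ℕ} (T : Fin n → Fin n → Fin n → ℝ)
    (hT : ∀ a b c, T a b c + T b c a + T c a b = 0) (v : Fin n → ℝ) :
    ∑ a, ∑ b, ∑ c, T a b c * v a * v b * v c = 0 := by
  have h1 : ∑ a, ∑ b, ∑ c, T b c a * v a * v b * v c
      = ∑ a, ∑ b, ∑ c, T a b c * v a * v b * v c := by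
    rw [Finset.sum_comm]
    refine Finset.sum_congr rfl fun a _ => ?_
    rw [Finset.sum_comm]
    exact Finset.sum_congr rfl fun b _ => Finset.sum_congr rfl fun c _ => by ring
  have h2 : ∑ a, ∑ b, ∑ c, T c a b * v a * v b * v c
      = ∑ a, ∑ b, ∑ c, T a b c * v a * v b * v c := by
    refine (Finset.sum_congr rfl fun a _ => Finset.sum_comm).trans ?_
    rw [Finset.sum_comm]
    exact Finset.sum_congr rfl fun a _ => Finset.sum_congr rfl fun b _ =>
      Finset.sum_congr rfl fun c _ => by ring
  have h3 : ∑ a, ∑ b, ∑ c, T a b c * v a * v b * v c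
      + ∑ a, ∑ b, ∑ c, T b c a * v a * v b * v c
      + ∑ a, ∑ b, ∑ c, T c a b * v a * v b * v c = 0 := by
    simp only [← Finset.sum_add_distrib]
    refine Finset.sum_eq_zero fun a _ => Finset.sum_eq_zero fun b _ =>
      Finset.sum_eq_zero fun c _ => ?_
    linear_combination v a * v b * v c * hT a b c
  linarith

/-- Chain rule along a curve, in terms of partial derivatives. -/
theorem hasDerivAt_comp_curve {n : ℕ} {f : (Fin n → ℝ) → ℝ} {q : ℝ → Fin n → ℝ}
    {v : Fin n → ℝ} {t : ℝ} (hf : ContDiff ℝ ∞ f) (hq : HasDerivAt q v t) :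
    HasDerivAt (fun s => f (q s)) (∑ c, pd f (q t) c * v c) t := by
  have h := ((hf.differentiable (by simp)) (q t)).hasFDerivAt.comp_hasDerivAt t hq
  have e : fderiv ℝ f (q t) v = ∑ c, pd f (q t) c * v c := by
    conv_lhs => rw [← (Pi.basisFun ℝ (Fin n)).sum_repr v]
    simp [pd, mul_comm]
  rwa [e] at h

/-- Along a curve, the quadratic form of a Killing tensor in the velocity changes only through
the acceleration. -/
theorem hasDerivAt_killing_quadratic {n : ℕ} {K : (Fin n → ℝ) → Fin n → Fin n → ℝ}
    (hK : ∀ a b, ContDiff ℝ ∞ (fun x => K x a b)) (hsym : ∀ x a b, K x a b = K x b a)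
    (hKT : ∀ x a b c,
      pd (fun y => K y a b) x c + pd (fun y => K y b c) x a + pd (fun y => K y c a) x b = 0)
    {q v : ℝ → Fin n → ℝ} {w : Fin n → ℝ} {t : ℝ}
    (hq : HasDerivAt q (v t) t) (hv : HasDerivAt v w t) :
    HasDerivAt (fun s => ∑ a, ∑ b, K (q s) a b * v s a * v s b)
      (2 * ∑ a, ∑ b, K (q t) a b * v t a * w b) t := by
  have hv' := hasDerivAt_pi.1 hv
  have h := HasDerivAt.fun_sum (u := Finset.univ) fun a _ =>
    HasDerivAt.fun_sum (u := Finset.univ) fun b _ =>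
      ((hasDerivAt_comp_curve (hK a b) hq).mul (hv' a)).mul (hv' b)
  refine h.congr_deriv ?_
  have hc := sum_cubic_eq_zero_of_cyclic (fun a b c => pd (fun y => K y a b) (q t) c)
    (hKT (q t)) (v t)
  have hs : ∑ a, ∑ b, K (q t) a b * w a * v t b = ∑ a, ∑ b, K (q t) a b * v t a * w b := by
    rw [Finset.sum_comm]
    refine Finset.sum_congr rfl fun a _ => Finset.sum_congr rfl fun b _ => ?_
    rw [hsym]
    ring
  have hc' : ∑ a, ∑ b, (∑ c, pd (fun y => K y a b) (q t) c * v t c) * v t a * v t b = 0 := by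
    rw [← hc]
    simp only [Finset.sum_mul]
    exact Finset.sum_congr rfl fun a _ => Finset.sum_congr rfl fun b _ =>
      Finset.sum_congr rfl fun c _ => by ring
  simp only [Pi.mul_apply, add_mul, Finset.sum_add_distrib]
  rw [hc', hs]
  ring

/-- Integral 1 of the main Theorem (Euclidean case): given a Killing tensor `C_{ab}`, a
vector `L_a` whose symmetrized derivative is a Killing tensor, the compatibility condition
`∂_a(L_b∂_bV) = −2L_{(a,b)}∂_bV`, and `G` with `∂_aG = 2C_{ab}∂_bV − L_a`, the quantity
`I₁ = −(t²/2)L_{(a,b)}q̇^aq̇^b + C_{ab}q̇^aq̇^b + tL_aq̇^a + (t²/2)L_a∂_aV + G` is constant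
along every C² solution of `q̈^a = −∂V/∂q^a`. -/
theorem stmt1 (n : ℕ) (hn : 1 ≤ n) (V : (Fin n → ℝ) → ℝ) (hV : ContDiff ℝ ∞ V)
    (C : (Fin n → ℝ) → Fin n → Fin n → ℝ)
    (hCsmooth : ∀ a b, ContDiff ℝ ∞ (fun q => C q a b))
    (hCsym : ∀ q a b, C q a b = C q b a)
    (hCKT : ∀ q a b c,
      pd (fun q => C q a b) q c + pd (fun q => C q b c) q a + pd (fun q => C q c a) q b = 0)
    (L : (Fin n → ℝ) → Fin n → ℝ)
    (hLsmooth : ∀ a, ContDiff ℝ ∞ (fun q => L q a))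
    (hLKT : ∀ q a b c,
      pd (fun q => symD L q a b) q c + pd (fun q => symD L q b c) q a
        + pd (fun q => symD L q c a) q b = 0)
    (hLV : ∀ q a,
      pd (fun q => ∑ b, L q b * pd V q b) q a = -2 * ∑ b, symD L q a b * pd V q b)
    (G : (Fin n → ℝ) → ℝ) (hGsmooth : ContDiff ℝ ∞ G)
    (hG : ∀ q a, pd G q a = 2 * (∑ b, C q a b * pd V q b) - L q a)
    (aJ bJ : ℝ) (q q' q'' : ℝ → Fin n → ℝ)
    (hq : ∀ t ∈ Ioo aJ bJ, HasDerivAt q (q' t) t)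
    (hq' : ∀ t ∈ Ioo aJ bJ, HasDerivAt q' (q'' t) t)
    (heq : ∀ t ∈ Ioo aJ bJ, ∀ a, q'' t a = -pd V (q t) a) :
    ∀ t₁ ∈ Ioo aJ bJ, ∀ t₂ ∈ Ioo aJ bJ,
      -(t₁^2 / 2) * (∑ a, ∑ b, symD L (q t₁) a b * q' t₁ a * q' t₁ b)
        + (∑ a, ∑ b, C (q t₁) a b * q' t₁ a * q' t₁ b)
        + t₁ * (∑ a, L (q t₁) a * q' t₁ a)
        + t₁^2 / 2 * (∑ a, L (q t₁) a * pd V (q t₁) a) + G (q t₁)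
      = -(t₂^2 / 2) * (∑ a, ∑ b, symD L (q t₂) a b * q' t₂ a * q' t₂ b)
        + (∑ a, ∑ b, C (q t₂) a b * q' t₂ a * q' t₂ b)
        + t₂ * (∑ a, L (q t₂) a * q' t₂ a)
        + t₂^2 / 2 * (∑ a, L (q t₂) a * pd V (q t₂) a) + G (q t₂) := by
  set F : ℝ → ℝ := fun t =>
    -(t^2 / 2) * (∑ a, ∑ b, symD L (q t) a b * q' t a * q' t b)
      + (∑ a, ∑ b, C (q t) a b * q' t a * q' t b)
      + t * (∑ a, L (q t) a * q' t a)
      + t^2 / 2 * (∑ a, L (q t) a * pd V (q t) a) + G (q t) with hF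
  have hF' : ∀ t ∈ Ioo aJ bJ, HasDerivAt F 0 t := by
    intro t ht
    have hsq : HasDerivAt (fun s : ℝ => s^2 / 2) t t := by
      simpa using (hasDerivAt_pow 2 t).div_const 2
    have hS := hasDerivAt_killing_quadratic (contDiff_symD hLsmooth) (symD_comm L) hLKT
      (hq t ht) (hq' t ht)
    have hC := hasDerivAt_killing_quadratic hCsmooth hCsym hCKT (hq t ht) (hq' t ht)
    have hL := HasDerivAt.fun_sum (u := Finset.univ) fun a _ =>
      (hasDerivAt_comp_curve (hLsmooth a) (hq t ht)).mul (hasDerivAt_pi.1 (hq' t ht) a)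
    have hW := hasDerivAt_comp_curve (f := fun x => ∑ b, L x b * pd V x b)
      (ContDiff.sum fun b _ => (hLsmooth b).mul (contDiff_pd hV b)) (hq t ht)
    have hGt := hasDerivAt_comp_curve hGsmooth (hq t ht)
    refine (((((hsq.neg.mul hS).add hC).add ((hasDerivAt_id t).mul hL)).add
      (hsq.mul hW)).add hGt).congr_deriv ?_
    have hform : ∀ K : Fin n → Fin n → ℝ, ∑ a, ∑ b, K a b * q' t a * pd V (q t) b
        = ∑ a, (∑ b, K a b * pd V (q t) b) * q' t a := by
      intro K
      simp only [Finset.sum_mul]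
      exact Finset.sum_congr rfl fun a _ => Finset.sum_congr rfl fun b _ => by ring
    simp only [heq t ht, hLV, hG, hform, Finset.sum_add_distrib, sum_pd_mul_mul_eq_sum_symD,
      sub_mul, Finset.sum_sub_distrib, mul_assoc (2 : ℝ), mul_assoc (-2 : ℝ), ← Finset.mul_sum,
      mul_neg, Finset.sum_neg_distrib, id, Pi.neg_apply, Pi.mul_apply]
    ring
  intro t₁ h₁ t₂ h₂
  exact isOpen_Ioo.is_const_of_deriv_eq_zero isPreconnected_Ioo
    (fun t ht => (hF' t ht).differentiableAt.differentiableWithinAt)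
    (fun t ht => (hF' t ht).deriv) h₁ h₂
end

section
/- (Corrected quadratic first integral for the superintegrable potential V_s2.) Let k₁, k₂, k₃ be real constants and, on the open set {(x,y) : x ≠ 0}, set V(x,y) = (k₁/2)(x² + 4y²) + k₂/x² + k₃ y. Along every C² solution (x(t), y(t)) of ẍ = −V_x, ÿ = −V_y remaining in this set, the three quantities I_{s2a} = ẋ(y ẋ − x ẏ) − k₁ y x² + 2 k₂ y/x² − (k₃/2) x², I_{s2b} = ẋ²/2 + (k₁/2) x² + k₂/x², and I_{s2c} = ẏ²/2 + 2 k₁ y² + k₃ y are each constant in t. -/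
open Real

noncomputable def pX (V : ℝ × ℝ → ℝ) (p : ℝ × ℝ) : ℝ := fderiv ℝ V p (1, 0)
noncomputable def pY (V : ℝ × ℝ → ℝ) (p : ℝ × ℝ) : ℝ := fderiv ℝ V p (0, 1)

theorem hasFDerivAt_potential (k₁ k₂ k₃ : ℝ) {p : ℝ × ℝ} (hp : p.1 ≠ 0) :
    HasFDerivAt (fun p : ℝ × ℝ => k₁ / 2 * (p.1^2 + 4 * p.2^2) + k₂ / p.1^2 + k₃ * p.2)
      ((k₁ * p.1 - 2 * k₂ / p.1^3) • ContinuousLinearMap.fst ℝ ℝ ℝ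
        + (4 * k₁ * p.2 + k₃) • ContinuousLinearMap.snd ℝ ℝ ℝ) p := by
  have hX : HasDerivAt (fun u : ℝ => k₁ / 2 * u^2 + k₂ / u^2) (k₁ * p.1 - 2 * k₂ / p.1^3) p.1 := by
    refine ((((hasDerivAt_id p.1).pow 2).const_mul (k₁ / 2)).add
      ((hasDerivAt_const p.1 k₂).div ((hasDerivAt_id p.1).pow 2)
        (pow_ne_zero 2 hp))).congr_deriv ?_
    simp only [Pi.pow_apply, id_eq]
    field_simp
    ring
  have hY : HasDerivAt (fun v : ℝ => 2 * k₁ * v^2 + k₃ * v) (4 * k₁ * p.2 + k₃) p.2 := by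
    refine ((((hasDerivAt_id p.2).pow 2).const_mul (2 * k₁)).add
      ((hasDerivAt_id p.2).const_mul k₃)).congr_deriv ?_
    simp only [id_eq]
    ring
  refine ((hX.comp_hasFDerivAt p (hasFDerivAt_fst (𝕜 := ℝ))).add
    (hY.comp_hasFDerivAt p (hasFDerivAt_snd (𝕜 := ℝ)))).congr_of_eventuallyEq (.of_forall fun q => ?_)
  simp only [Pi.add_apply, Function.comp_apply]
  ring

theorem eq_of_hasDerivAt_zero {f : ℝ → ℝ} (hf : ∀ t, HasDerivAt f 0 t) (t₁ t₂ : ℝ) :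
    f t₁ = f t₂ :=
  is_const_of_deriv_eq_zero (fun t => (hf t).differentiableAt) (fun t => (hf t).deriv) t₁ t₂

/-- Corrected quadratic first integral for the superintegrable potential
`V_s2 = (k₁/2)(x² + 4y²) + k₂/x² + k₃y` on `{x ≠ 0}`: the three quantities
`I_{s2a}`, `I_{s2b}`, `I_{s2c}` are constant along solutions remaining in this set. -/
theorem stmt18 (k₁ k₂ k₃ : ℝ) (x y x' y' : ℝ → ℝ) (hdom : ∀ t, x t ≠ 0)
    (hx : ∀ t, HasDerivAt x (x' t) t) (hy : ∀ t, HasDerivAt y (y' t) t)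
    (hx' : ∀ t, HasDerivAt x'
      (-(pX (fun p : ℝ × ℝ => k₁ / 2 * (p.1^2 + 4 * p.2^2) + k₂ / p.1^2 + k₃ * p.2)
        (x t, y t))) t)
    (hy' : ∀ t, HasDerivAt y'
      (-(pY (fun p : ℝ × ℝ => k₁ / 2 * (p.1^2 + 4 * p.2^2) + k₂ / p.1^2 + k₃ * p.2)
        (x t, y t))) t) :
    (∀ t₁ t₂, x' t₁ * (y t₁ * x' t₁ - x t₁ * y' t₁) - k₁ * y t₁ * (x t₁)^2
                + 2 * k₂ * y t₁ / (x t₁)^2 - k₃ / 2 * (x t₁)^2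
            = x' t₂ * (y t₂ * x' t₂ - x t₂ * y' t₂) - k₁ * y t₂ * (x t₂)^2
                + 2 * k₂ * y t₂ / (x t₂)^2 - k₃ / 2 * (x t₂)^2) ∧
    (∀ t₁ t₂, (x' t₁)^2 / 2 + k₁ / 2 * (x t₁)^2 + k₂ / (x t₁)^2
            = (x' t₂)^2 / 2 + k₁ / 2 * (x t₂)^2 + k₂ / (x t₂)^2) ∧
    (∀ t₁ t₂, (y' t₁)^2 / 2 + 2 * k₁ * (y t₁)^2 + k₃ * y t₁
            = (y' t₂)^2 / 2 + 2 * k₁ * (y t₂)^2 + k₃ * y t₂) := by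
  replace hx' (t) : HasDerivAt x' (-(k₁ * x t - 2 * k₂ / x t^3)) t := by
    simpa [pX, (hasFDerivAt_potential k₁ k₂ k₃ (p := (x t, y t)) (hdom t)).fderiv] using hx' t
  replace hy' (t) : HasDerivAt y' (-(4 * k₁ * y t + k₃)) t := by
    simpa only [pY, (hasFDerivAt_potential k₁ k₂ k₃ (p := (x t, y t)) (hdom t)).fderiv,
      add_apply, smul_apply, ContinuousLinearMap.coe_fst', ContinuousLinearMap.coe_snd',
      smul_eq_mul, mul_zero, mul_one, zero_add] using hy' t
  have hx2 (t) : HasDerivAt (fun s => x s^2) (2 * x t * x' t) t :=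
    ((hx t).pow 2).congr_deriv (by ring)
  refine ⟨eq_of_hasDerivAt_zero fun t => ?_, eq_of_hasDerivAt_zero fun t => ?_,
    eq_of_hasDerivAt_zero fun t => ?_⟩
  · have hne := hdom t
    refine (((((hx' t).mul (((hy t).mul (hx' t)).sub ((hx t).mul (hy' t)))).sub
      (((hy t).const_mul k₁).mul (hx2 t))).add
      (((hy t).const_mul (2 * k₂)).div (hx2 t) (pow_ne_zero 2 hne))).sub
      ((hx2 t).const_mul (k₃ / 2))).congr_deriv ?_
    simp only [Pi.mul_apply, Pi.sub_apply]
    field_simp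
    ring
  · have hne := hdom t
    refine (((((hx' t).pow 2).div_const 2).add ((hx2 t).const_mul (k₁ / 2))).add
      ((hasDerivAt_const t k₂).div (hx2 t) (pow_ne_zero 2 hne))).congr_deriv ?_
    field_simp
    ring
  · refine (((((hy' t).pow 2).div_const 2).add (((hy t).pow 2).const_mul (2 * k₁))).add
      ((hy t).const_mul k₃)).congr_deriv ?_
    ring
end
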